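/- Step in Proposition 3.11 (equality of Laplacians). Let R be a unital ℂ-*-algebra and let d, I ∈ R with I* = −I and [I,[I,d]] = −d. Set d₂ := [I,d]. If d* d₂ + d₂ d* = 0, then d d* + d* d = d₂ d₂* + d₂* d₂. -/

import Mathlib

/-- Step in Proposition 3.11: with `I* = −I`, `[I,[I,d]] = −d` and `d₂ = [I,d]`,
if `{d*,d₂} = 0` then the Laplacians agree: `{d,d*} = {d₂,d₂*}`. -/
theorem equality_of_laplacians {R : Type*} [Ring R] [Algebra ℂ R]
    [StarRing R] [StarModule ℂ R]
    (d I d₂ : R)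
    (hI : star I = -I)
    (hd₂ : d₂ = I * d - d * I)
    (hII : I * d₂ - d₂ * I = -d)
    (h : star d * d₂ + d₂ * star d = 0) :
    d * star d + star d * d = d₂ * star d₂ + star d₂ * d₂ := by
  have hstar : star d₂ = I * star d - star d * I := by
    rw [hd₂, star_sub, star_mul, star_mul, hI]
    noncomm_ring
  rw [hstar]
  linear_combination (norm := noncomm_ring) star d * hII + hII * star d - I * h + h * I
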